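/- Let (K,∂) be a differential field of characteristic 0 whose underlying field K is algebraically closed, and let t, c ∈ K satisfy ∂t = 1, ∂c = 0, and t ≠ c. Then the set {y ∈ K : y ≠ 0, ∂y = −(1/2)·y³, and t − 1/y² = c} has exactly two elements, and these two elements are negatives of each other. (Section 5 of the paper: the first integral h(t,y) = t − 1/y² of y' = −(1/2)y³ is finite-to-one but not injective — both particular solutions 1/√(t−c) and −1/√(t−c) lie in the preimage of c — so the equation is generically almost internal to the constants but not generically internal.) -/

import Mathlib

/-- Section 5: over an algebraically closed differential field, if `∂t = 1`, `∂c = 0` and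
`t ≠ c`, then the fibre of the first integral `h(t,y) = t − 1/y²` of `y' = −(1/2)y³` over the
constant `c` consists of exactly two solutions, which are negatives of each other. -/
theorem fibre_of_first_integral_has_two_points
    {K : Type*} [Field K] [IsAlgClosed K] [CharZero K] (D : Derivation ℤ K K)
    (t c : K) (ht : D t = 1) (hc : D c = 0) (htc : t ≠ c) :
    ∃ a : K, a ≠ -a ∧
      {y : K | y ≠ 0 ∧ D y = -(1/2) * y ^ 3 ∧ t - 1 / y ^ 2 = c} = {a, -a} := by
  have hs : t - c ≠ 0 := sub_ne_zero.mpr htc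
  obtain ⟨a, ha⟩ := IsAlgClosed.exists_pow_nat_eq (t - c)⁻¹ (n := 2) two_pos
  have ha0 : a ≠ 0 := by
    rintro rfl
    exact inv_ne_zero hs (by rw [← ha]; ring)
  have has : a * a * (t - c) = 1 := by
    rw [← sq, ha, inv_mul_cancel₀ hs]
  have hDa : D a = -(1/2) * a ^ 3 := by
    have h := congrArg D has
    simp only [Derivation.leibniz, map_sub, ht, hc, smul_eq_mul, Derivation.map_one_eq_zero] at h
    linear_combination (a / 2) * h - D a * has
  have hfib : t - 1 / a ^ 2 = c := by
    rw [ha, one_div, inv_inv, sub_sub_cancel]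
  refine ⟨a, self_ne_neg.mpr ha0, ?_⟩
  ext y
  simp only [Set.mem_ofPred_eq, Set.mem_insert_iff, Set.mem_singleton_iff]
  constructor
  · rintro ⟨-, -, hy⟩
    refine sq_eq_sq_iff_eq_or_eq_neg.mp ?_
    rw [ha, ← hy, sub_sub_cancel, one_div, inv_inv]
  · rintro (rfl | rfl)
    · exact ⟨ha0, hDa, hfib⟩
    · refine ⟨neg_ne_zero.mpr ha0, ?_, by rwa [neg_sq]⟩
      rw [map_neg, hDa]
      ring
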